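/- Let f ∈ E_rad be nonzero and φ = φ_f. Then: (a) for every ℓ > 0, a_φ(e,ℓ) = 0 for all e ≤ e_{φ,ℓ}, and a_φ(e,ℓ) → +∞ as e → 0⁻; (b) the quantity m_φ := inf_{r≥0} (r+1)|φ(r)| satisfies 0 < m_φ < ∞; (c) for every ℓ > 0 and e < 0, a_φ(e,ℓ) ≤ 16π² |e|^{−1/2} |f|_{L¹}; (d) for every ℓ > 0 and every e with −m_φ²/(4(2m_φ + ℓ)) ≤ e < 0, a_φ(e,ℓ) ≥ (4π²/3) |e|^{−1/2} m_φ. -/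

import Mathlib

noncomputable section

open MeasureTheory Real Filter Set Topology
open scoped ENNReal NNReal

abbrev E3 : Type := EuclideanSpace ℝ (Fin 3)
abbrev Phase : Type := E3 × E3

/-- Spherical symmetry: invariance under all rotations of `ℝ³` acting jointly on `x` and `v`. -/
def SphSym (f : Phase → ℝ) : Prop :=
  ∀ R : E3 ≃ₗᵢ[ℝ] E3, LinearMap.det (R.toLinearEquiv : E3 →ₗ[ℝ] E3) = 1 →
    ∀ z : Phase, f (R z.1, R z.2) = f z

/-- `|x × v|²`, via the Lagrange identity. -/
def ellOf (z : Phase) : ℝ := ‖z.1‖ ^ 2 * ‖z.2‖ ^ 2 - (inner ℝ z.1 z.2 : ℝ) ^ 2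

/-- Spatial density. -/
def rhoF (f : Phase → ℝ) (x : E3) : ℝ := ∫ v : E3, f (x, v)

/-- Poisson field. -/
def phiF (f : Phase → ℝ) (x : E3) : ℝ := - ∫ y : E3, rhoF f y / (4 * π * ‖x - y‖)

/-- Radial representation of the Poisson field. -/
def phiRad (f : Phase → ℝ) (r : ℝ) : ℝ :=
  phiF f (r • (EuclideanSpace.single (0 : Fin 3) (1:ℝ)))

def mass (f : Phase → ℝ) : ℝ := ∫ z : Phase, f z

def kineticE (f : Phase → ℝ) : ℝ := ∫ z : Phase, ‖z.2‖ ^ 2 * f z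

def gradPhi (f : Phase → ℝ) (x : E3) : E3 := gradient (phiF f) x

def fieldSq (f : Phase → ℝ) : ℝ := ∫ x : E3, ‖gradPhi f x‖ ^ 2

/-- `L²` distance between the force fields of `f` and `g`. -/
def fieldDist (f g : Phase → ℝ) : ℝ :=
  Real.sqrt (∫ x : E3, ‖gradPhi f x - gradPhi g x‖ ^ 2)

/-- The Hamiltonian. -/
def Ham (f : Phase → ℝ) : ℝ := kineticE f / 2 - fieldSq f / 2

/-- The norm of the energy space. -/
def eNormE (f : Phase → ℝ) : ℝ≥0∞ :=
  eLpNorm f 1 volume + eLpNorm f ⊤ volume +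
    ∫⁻ z : Phase, (‖z.2‖₊ : ℝ≥0∞) ^ 2 * (‖f z‖₊ : ℝ≥0∞)

def memE (f : Phase → ℝ) : Prop := Measurable f ∧ (∀ z, 0 ≤ f z) ∧ eNormE f < ⊤

def memErad (f : Phase → ℝ) : Prop := memE f ∧ SphSym f

/-- Density of the measure `ν_ℓ`. -/
def nuDens (ℓ : ℝ) (p : ℝ × ℝ) : ℝ≥0∞ :=
  if 0 < p.1 ∧ ℓ < p.1 ^ 2 * p.2 ^ 2 then
    ENNReal.ofReal (4 * π ^ 2 * p.1 * |p.2| / Real.sqrt (p.1 ^ 2 * p.2 ^ 2 - ℓ))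
  else 0

def nuMeas (ℓ : ℝ) : Measure (ℝ × ℝ) := volume.withDensity (nuDens ℓ)

/-- Representative phase point with `|x| = r`, `|v| = |u|`, `|x×v|² = ℓ` and
`x·v = sign u · √(r²u²-ℓ)`. -/
def radPoint (r u ℓ : ℝ) : Phase :=
  (r • (EuclideanSpace.single (0 : Fin 3) (1:ℝ)),
   (Real.sign u * Real.sqrt (r ^ 2 * u ^ 2 - ℓ) / r) • (EuclideanSpace.single (0 : Fin 3) (1:ℝ))
     + (Real.sqrt ℓ / r) • (EuclideanSpace.single (1 : Fin 3) (1:ℝ)))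

/-- Distribution function of `f` at kinetic momentum `ℓ`. -/
def muDist (f : Phase → ℝ) (s ℓ : ℝ) : ℝ≥0∞ :=
  nuMeas ℓ {p : ℝ × ℝ | s < f (radPoint p.1 p.2 ℓ)}

/-- `g ∈ Eq(f)` : `g` is nonnegative, spherically symmetric and equimeasurable to `f`
at (almost) every kinetic momentum `ℓ`. -/
def EqMeas (f g : Phase → ℝ) : Prop :=
  (∀ z, 0 ≤ g z) ∧ SphSym g ∧
    ∀ s : ℝ, 0 < s →
      ∀ᵐ ℓ ∂(volume.restrict (Ioi (0:ℝ))), muDist g s ℓ = muDist f s ℓ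

/-- Schwarz symmetrization of `f` at fixed `ℓ`. -/
def schwarz (f : Phase → ℝ) (t ℓ : ℝ) : ℝ :=
  if ENNReal.ofReal t < muDist f 0 ℓ then
    sSup {s : ℝ | 0 ≤ s ∧ ENNReal.ofReal t < muDist f s ℓ}
  else 0

/-- Effective potential. -/
def psiPot (φ : ℝ → ℝ) (ℓ r : ℝ) : ℝ := φ r + ℓ / (2 * r ^ 2)

def eMinPot (φ : ℝ → ℝ) (ℓ : ℝ) : ℝ := sInf (psiPot φ ℓ '' Ioi 0)

def r1Pot (φ : ℝ → ℝ) (e ℓ : ℝ) : ℝ := sInf {r : ℝ | 0 < r ∧ psiPot φ ℓ r < e}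

def r2Pot (φ : ℝ → ℝ) (e ℓ : ℝ) : ℝ := sSup {r : ℝ | 0 < r ∧ psiPot φ ℓ r < e}

/-- The Jacobian `a_φ(e, ℓ)` (meaningful for `e < 0`). -/
def aPot (φ : ℝ → ℝ) (e ℓ : ℝ) : ℝ :=
  8 * π ^ 2 * Real.sqrt 2 * ∫ r in Ioi (0:ℝ), Real.sqrt (max (e - psiPot φ ℓ r) 0)

/-- Inverse of the bijection `e ↦ a_φ(e,ℓ)` from `(e_{φ,ℓ},0)` onto `(0,∞)`. -/
def aPotInv (φ : ℝ → ℝ) (s ℓ : ℝ) : ℝ :=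
  sSup {e : ℝ | eMinPot φ ℓ < e ∧ e < 0 ∧ aPot φ e ℓ < s}

/-- Microscopic energy w.r.t. the Poisson field of `g`. -/
def microE (g : Phase → ℝ) (z : Phase) : ℝ := ‖z.2‖ ^ 2 / 2 + phiF g z.1

/-- Rearrangement of `f` with respect to the microscopic energy of the field of `g`. -/
def rearr (f g : Phase → ℝ) (z : Phase) : ℝ :=
  if microE g z < 0 then
    schwarz f (aPot (phiRad g) (microE g z) (ellOf z)) (ellOf z)
  else 0

/-- Assumption (A). -/
structure AssumptionA (Q : Phase → ℝ) (F : ℝ → ℝ → ℝ) (e₀ : ℝ) : Prop where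
  contQ : Continuous Q
  nonneg : ∀ z, 0 ≤ Q z
  nonzero : Q ≠ 0
  cpt : HasCompactSupport Q
  sph : SphSym Q
  eqF : ∀ z : Phase, Q z = F (microE Q z) (ellOf z)
  Fnonneg : ∀ e ℓ, 0 ≤ ℓ → 0 ≤ F e ℓ
  Fcont : ContinuousOn (fun p : ℝ × ℝ => F p.1 p.2) {p : ℝ × ℝ | 0 ≤ p.2}
  e₀neg : e₀ < 0
  Fsupp : ∀ e ℓ, 0 ≤ ℓ → 0 < F e ℓ → e < e₀
  FC1 : ContDiffOn ℝ 1 (fun p : ℝ × ℝ => F p.1 p.2) {p : ℝ × ℝ | 0 ≤ p.2 ∧ 0 < F p.1 p.2}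
  FeNeg : ∀ e ℓ, 0 ≤ ℓ → 0 < F e ℓ → deriv (fun e' => F e' ℓ) e < 0

/-- The reduced functional `J_{f^*}(φ_g) = H(f^{*φ_g}) + ½|∇φ_g − ∇φ_{f^{*φ_g}}|²`. -/
def Jred (f g : Phase → ℝ) : ℝ :=
  Ham (rearr f g) + (∫ x : E3, ‖gradPhi g x - gradPhi (rearr f g) x‖ ^ 2) / 2

def distL1 (f g : Phase → ℝ) : ℝ := ∫ z : Phase, |f z - g z|

def distL1v (f g : Phase → ℝ) : ℝ := ∫ z : Phase, ‖z.2‖ ^ 2 * |f z - g z|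


/-- `m_φ = inf_{r ≥ 0} (r+1)|φ(r)|`. -/
def mPhi (f : Phase → ℝ) : ℝ := sInf ((fun r => (r + 1) * |phiRad f r|) '' Ici 0)


abbrev e0v : E3 := EuclideanSpace.single (0 : Fin 3) (1:ℝ)

lemma aux_polar (g h : _ → ℝ≥0∞) (hg : Measurable g) (hh : Measurable h)
    (hom : ∀ t : ℝ, 0 < t → ∀ y : E3, h (t • y) = h y) :
    ∫⁻ y : E3, g ‖y‖ * h y =
      (∫⁻ w, h (w : E3) ∂((volume : Measure E3).toSphere)) *
      ∫⁻ t, g (t : ℝ) ∂(Measure.volumeIoiPow (Module.finrank ℝ E3 - 1)) := by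
  have h1 : ∫⁻ y : E3, g ‖y‖ * h y =
      ∫⁻ y : ({(0:E3)}ᶜ : Set E3), g ‖y.1‖ * h y.1 ∂((volume : Measure E3).comap (↑)) := by
    rw [lintegral_subtype_comap (measurableSet_singleton _).compl (fun y : E3 => g ‖y‖ * h y),
      restrict_compl_singleton]
  rw [h1]
  have h2 := ((volume : Measure E3).measurePreserving_homeomorphUnitSphereProd).lintegral_comp_emb
    (Homeomorph.measurableEmbedding _) (fun p => h (p.1 : E3) * g (p.2 : ℝ))
  rw [← lintegral_prod_mul (by fun_prop) (by fun_prop), ← h2]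
  refine lintegral_congr fun y => ?_
  have hy : 0 < ‖y.1‖ := norm_pos_iff.2 y.2
  simp only [homeomorphUnitSphereProd_apply_snd_coe, homeomorphUnitSphereProd_apply_fst_coe]
  rw [hom _ (by positivity), mul_comm]

lemma aux_polar2 (g h : _ → ℝ≥0∞) (hg : Measurable g) (hh : Measurable h)
    (hom : ∀ t : ℝ, 0 < t → ∀ y : E3, h (t • y) = h y) :
    (∫⁻ y : E3, g ‖y‖ * h y) * volume (Metric.ball (0:E3) 1) =
      (∫⁻ y : E3, g ‖y‖) * ∫⁻ y in Metric.ball (0:E3) 1, h y := by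
  have e1 := aux_polar g h hg hh hom
  have e2 := aux_polar g 1 hg measurable_const (by simp)
  have hI : Measurable ((Iio (1:ℝ)).indicator (1 : ℝ → ℝ≥0∞)) :=
    measurable_one.indicator measurableSet_Iio
  have e3 := aux_polar ((Iio (1:ℝ)).indicator 1) h hI hh hom
  have e4 := aux_polar ((Iio (1:ℝ)).indicator 1) 1 hI measurable_const (by simp)
  simp only [Pi.one_apply, mul_one] at e2 e4
  have e5 : ∫⁻ y in Metric.ball (0:E3) 1, h y
      = ∫⁻ y : E3, (Iio (1:ℝ)).indicator 1 ‖y‖ * h y := by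
    rw [← lintegral_indicator measurableSet_ball]
    refine lintegral_congr fun y => ?_
    by_cases hy : ‖y‖ < 1 <;> simp [indicator, hy]
  have e6 : volume (Metric.ball (0:E3) 1)
      = ∫⁻ y : E3, (Iio (1:ℝ)).indicator 1 ‖y‖ := by
    rw [← lintegral_indicator_one measurableSet_ball]
    refine lintegral_congr fun y => ?_
    by_cases hy : ‖y‖ < 1 <;> simp [indicator, hy]
  rw [e5, e6, e1, e2, e3, e4]
  ring

/-- the 0-homogeneous weight -/
def hw (y : E3) : ℝ := ‖y‖ / Real.sqrt (2 * |y 1| * |y 2|)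

lemma hw_hom (t : ℝ) (ht : 0 < t) (y : E3) : hw (t • y) = hw y := by
  unfold hw
  have : 2 * |(t • y) 1| * |(t • y) 2| = t ^ 2 * (2 * |y 1| * |y 2|) := by
    simp [abs_mul, abs_of_pos ht]; ring
  rw [this, Real.sqrt_mul (by positivity), Real.sqrt_sq ht.le, norm_smul, Real.norm_eq_abs,
    abs_of_pos ht, mul_div_mul_left _ _ ht.ne']

lemma hw_meas : Measurable hw := by
  unfold hw
  fun_prop

lemma ae_coord (i : Fin 3) : ∀ᵐ y : E3, y i ≠ 0 := by
  have := Measure.addHaar_submodule (volume : Measure E3)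
    (LinearMap.ker (EuclideanSpace.proj (𝕜 := ℝ) i : E3 →L[ℝ] ℝ).toLinearMap) (by
      intro h
      have h2 : (EuclideanSpace.single i (1:ℝ) : E3) ∈
        LinearMap.ker (EuclideanSpace.proj (𝕜 := ℝ) i : E3 →L[ℝ] ℝ).toLinearMap := by
        rw [h]; trivial
      simp at h2)
  rw [ae_iff]
  convert this using 2
  ext y
  simp

lemma dist_ge (r : ℝ) (hr : 0 < r) (y : E3) :
    r * Real.sqrt (2 * |y 1| * |y 2|) ≤ ‖r • e0v - y‖ * ‖y‖ := by
  rw [EuclideanSpace.norm_eq, EuclideanSpace.norm_eq, ← Real.sqrt_mul (by positivity)]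
  apply Real.le_sqrt_of_sq_le
  rw [mul_pow, Real.sq_sqrt (by positivity)]
  simp [Fin.sum_univ_three, e0v]
  have h1 : 2 * |y 1| * |y 2| ≤ y 1 ^ 2 + y 2 ^ 2 := by
    rw [← sq_abs (y 1), ← sq_abs (y 2)]; nlinarith [sq_nonneg (|y 1| - |y 2|)]
  have h2 : r ^ 2 * (2 * |y 1| * |y 2|) ≤ r ^ 2 * (y 1 ^ 2 + y 2 ^ 2) := by gcongr
  nlinarith [sq_nonneg ((r - y 0) * y 0 - (y 1 ^ 2 + y 2 ^ 2))]

lemma inv_dist_le (r : ℝ) (hr : 0 < r) (y : E3) (h1 : y 1 ≠ 0) (h2 : y 2 ≠ 0) :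
    1 / ‖r • e0v - y‖ ≤ hw y / r := by
  have h := dist_ge r hr y
  have hs : 0 < Real.sqrt (2 * |y 1| * |y 2|) := by positivity
  have hp : 0 < ‖r • e0v - y‖ := by
    by_contra hc
    have : ‖r • e0v - y‖ = 0 := le_antisymm (not_lt.1 hc) (norm_nonneg _)
    rw [this] at h
    nlinarith [mul_pos hr hs]
  unfold hw
  rw [div_div, div_le_div_iff₀ hp (by positivity)]
  linarith

def kf (t : ℝ) : ℝ := (Iio (1:ℝ)).indicator (fun s => s ^ (-(1/2) : ℝ)) |t|

def kg (t : ℝ) : ℝ := (Iio (1:ℝ)).indicator (fun _ => 1) |t|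

lemma kf_int : Integrable kf := by
  have : IntegrableOn (fun t : ℝ => |t| ^ (-(1/2) : ℝ)) (Metric.ball 0 1) := by
    refine integrableOn_ball_of_norm_le_rpow (C := 1) (α := 1/2) (by simp) (by norm_num [Module.finrank_self]) ?_
      (by exact (measurable_id.abs.pow_const _).aestronglyMeasurable)
    refine Eventually.of_forall fun x => ?_
    simp only [one_mul, Real.norm_eq_abs]
    rw [abs_of_nonneg (by positivity)]
  rw [← integrable_indicator_iff measurableSet_ball] at this
  refine this.congr (Eventually.of_forall fun t => ?_)
  by_cases ht : |t| < 1 <;> simp [kf, indicator, ht]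

lemma kf_val : ∫ t, kf t = 4 := by
  unfold kf
  rw [integral_comp_abs (f := (Iio (1:ℝ)).indicator (fun s => s ^ (-(1/2) : ℝ))),
    setIntegral_indicator measurableSet_Iio, Ioi_inter_Iio, ← integral_Ioc_eq_integral_Ioo,
    ← intervalIntegral.integral_of_le zero_le_one, integral_rpow (by norm_num)]
  norm_num

lemma kg_int : Integrable kg := by
  have : IntegrableOn (fun t : ℝ => (1:ℝ)) (Metric.ball (0:ℝ) 1) := by
    simp
  rw [← integrable_indicator_iff measurableSet_ball] at this
  refine this.congr (Eventually.of_forall fun t => ?_)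
  by_cases ht : |t| < 1 <;> simp [kg, indicator, ht]

lemma kg_val : ∫ t, kg t = 2 := by
  unfold kg
  rw [integral_comp_abs (f := (Iio (1:ℝ)).indicator (fun s => 1)),
    setIntegral_indicator measurableSet_Iio, Ioi_inter_Iio]
  simp

lemma kf_nn (t : ℝ) : 0 ≤ kf t := indicator_apply_nonneg (fun _ => by positivity)
lemma kg_nn (t : ℝ) : 0 ≤ kg t := indicator_apply_nonneg (fun _ => by positivity)

lemma hw_ball : ∫⁻ y in Metric.ball (0:E3) 1, ENNReal.ofReal (hw y) ≤ ENNReal.ofReal (16 * Real.sqrt 2) := by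
  let F : Fin 3 → ℝ → ℝ := ![kg, kf, kf]
  have hF : ∀ i, Integrable (F i) := by
    intro i; fin_cases i
    · exact kg_int
    · exact kf_int
    · exact kf_int
  have hint : Integrable (fun y : Fin 3 → ℝ => ∏ i, F i (y i)) :=
    Integrable.fintype_prod_dep hF
  have hval : ∫ y : Fin 3 → ℝ, ∏ i, F i (y i) = 32 := by
    rw [integral_fintype_prod_volume_eq_prod]
    simp [Fin.prod_univ_three, F, kf_val, kg_val]; norm_num
  have hnn : ∀ y : Fin 3 → ℝ, 0 ≤ ∏ i, F i (y i) := by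
    intro y
    simp only [Fin.prod_univ_three, F]
    exact mul_nonneg (mul_nonneg (kg_nn _) (kf_nn _)) (kf_nn _)
  have hl : ∫⁻ y : E3, ENNReal.ofReal (1 / Real.sqrt 2 * ∏ i, F i (y i)) = ENNReal.ofReal (16 * Real.sqrt 2) := by
    have := (PiLp.volume_preserving_ofLp (Fin 3)).lintegral_comp_emb
      (MeasurableEquiv.toLp 2 (Fin 3 → ℝ)).symm.measurableEmbedding
      (fun y : Fin 3 → ℝ => ENNReal.ofReal (1 / Real.sqrt 2 * ∏ i, F i (y i)))
    rw [this, ← ofReal_integral_eq_lintegral_ofReal (hint.const_mul _)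
      (Eventually.of_forall fun y => mul_nonneg (by positivity) (hnn y)), integral_const_mul, hval]
    congr 1
    field_simp
    rw [Real.sq_sqrt (by norm_num)]; norm_num
  rw [← hl, ← lintegral_indicator measurableSet_ball]
  refine lintegral_mono_ae ?_
  filter_upwards [ae_coord 1, ae_coord 2] with y h1 h2
  by_cases hy : ‖y‖ < 1
  · have hc : ∀ i, |y i| < 1 := fun i =>
      lt_of_le_of_lt (by simpa using PiLp.norm_apply_le y i) hy
    simp only [indicator, mem_ball_zero_iff, hy, if_true]
    apply ENNReal.ofReal_le_ofReal
    simp [Fin.prod_univ_three, F, kf, kg, indicator, hc]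
    unfold hw
    have hs : Real.sqrt (2 * |y 1| * |y 2|) = Real.sqrt 2 * (Real.sqrt |y 1| * Real.sqrt |y 2|) := by
      rw [mul_assoc, Real.sqrt_mul (by norm_num), Real.sqrt_mul (by positivity)]
    rw [hs, Real.rpow_neg (by positivity), Real.rpow_neg (by positivity)]
    have q : (2⁻¹ : ℝ) = 1/2 := by norm_num
    rw [q, ← Real.sqrt_eq_rpow, ← Real.sqrt_eq_rpow, ← mul_inv, ← mul_inv, div_eq_mul_inv]
    exact mul_le_of_le_one_left (by positivity) hy.le
  · simp [indicator, hy]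

lemma exists_rot (y : E3) : ∃ R : E3 ≃ₗᵢ[ℝ] E3,
    LinearMap.det (R.toLinearEquiv : E3 →ₗ[ℝ] E3) = 1 ∧ R (‖y‖ • e0v) = y := by
  have hn : ‖(‖y‖ • e0v)‖ = ‖y‖ := by simp [norm_smul]
  by_cases h : ‖y‖ • e0v = y
  · exact ⟨LinearIsometryEquiv.refl ℝ E3, by
      have : ((LinearIsometryEquiv.refl ℝ E3).toLinearEquiv : E3 →ₗ[ℝ] E3) = LinearMap.id := rfl
      rw [this, LinearMap.det_id], by simpa using h⟩
  · have key : ∀ v : E3, v ≠ 0 →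
        LinearMap.det (((Submodule.reflection (Submodule.span ℝ {v})ᗮ)).toLinearEquiv : E3 →ₗ[ℝ] E3) = -1 := by
      intro v hv
      have := Submodule.det_reflection (𝕜 := ℝ) ((Submodule.span ℝ {v})ᗮ)
      rw [Submodule.orthogonal_orthogonal, finrank_span_singleton hv] at this
      simpa using this
    let e1 : E3 := EuclideanSpace.single 1 (1:ℝ)
    have he1 : e1 ≠ 0 := by simp [e1]
    let R1 := Submodule.reflection (Submodule.span ℝ {e1})ᗮ
    let R2 := Submodule.reflection (Submodule.span ℝ {‖y‖ • e0v - y})ᗮ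
    refine ⟨R1.trans R2, ?_, ?_⟩
    · have : ((R1.trans R2).toLinearEquiv : E3 →ₗ[ℝ] E3)
        = (R2.toLinearEquiv : E3 →ₗ[ℝ] E3) ∘ₗ (R1.toLinearEquiv : E3 →ₗ[ℝ] E3) := rfl
      rw [this, LinearMap.det_comp, key _ he1, key _ (sub_ne_zero.2 h)]
      norm_num
    · have h1 : R1 (‖y‖ • e0v) = ‖y‖ • e0v := by
        apply Submodule.reflection_mem_subspace_eq_self
        rw [Submodule.mem_orthogonal_singleton_iff_inner_right]
        rw [inner_smul_right, mul_eq_zero]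
        right
        simp [e1, e0v, EuclideanSpace.inner_single_left]
      have h2 : R2 (‖y‖ • e0v) = y := Submodule.reflection_sub hn
      rw [LinearIsometryEquiv.trans_apply, h1, h2]

lemma memE_parts {f : Phase → ℝ} (hf : memE f) :
    Integrable f ∧ Integrable (fun z : Phase => ‖z.2‖ ^ 2 * f z) ∧
      ∃ B : ℝ, 0 ≤ B ∧ ∀ᵐ z, f z ≤ B := by
  obtain ⟨hm, hnn, hE⟩ := hf
  unfold eNormE at hE
  rw [ENNReal.add_lt_top, ENNReal.add_lt_top] at hE
  obtain ⟨⟨h1, h2⟩, h3⟩ := hE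
  refine ⟨memLp_one_iff_integrable.1 ⟨hm.aestronglyMeasurable, h1⟩,
    ⟨by fun_prop, ?_⟩, (eLpNorm f ⊤ volume).toReal, ENNReal.toReal_nonneg, ?_⟩
  · refine lt_of_le_of_lt (le_of_eq ?_) h3
    refine lintegral_congr fun z => ?_
    rw [enorm_mul, enorm_pow, enorm_norm]
    rfl
  · rw [eLpNorm_exponent_top] at h2 ⊢
    filter_upwards [ae_le_eLpNormEssSup (f := f) (μ := volume)] with z hz
    rw [← ENNReal.ofReal_le_iff_le_toReal h2.ne]
    refine le_trans (le_of_eq ?_) hz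
    rw [Real.enorm_eq_ofReal (hnn z)]

lemma int_phase {f : Phase → ℝ} (hf : memE f) (x : E3) :
    Integrable (fun z : Phase => f z / ‖x - z.1‖) := by
  obtain ⟨h1, h2, B, hB, h3⟩ := memE_parts hf
  obtain ⟨hm, hnn, -⟩ := hf
  have g1 : Integrable (fun y : E3 =>
      (Metric.ball (0:E3) 1).indicator (fun y => ‖y‖ ^ (-(11/4) : ℝ)) (x - y)) := by
    have : IntegrableOn (fun y : E3 => ‖y‖ ^ (-(11/4) : ℝ)) (Metric.ball 0 1) := by
      refine integrableOn_ball_of_norm_le_rpow (C := 1) (α := 11/4) (by simp) (by norm_num) ?_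
        (by exact (measurable_norm.pow_const _).aestronglyMeasurable)
      refine Eventually.of_forall fun x => ?_
      simp only [one_mul, Real.norm_eq_abs]
      rw [abs_of_nonneg (by positivity)]
    rw [← integrable_indicator_iff measurableSet_ball] at this
    exact this.comp_sub_left x
  have g2 : Integrable (fun v : E3 => (1 + ‖v‖) ^ (-(7/2) : ℝ)) :=
    integrable_one_add_norm (by norm_num)
  have g3 := (g1.mul_prod g2).const_mul (B * 4 ^ (7/4 : ℝ))
  refine ((h1.add h2).add g3).mono' (by exact Measurable.aestronglyMeasurable (by fun_prop)) ?_
  filter_upwards [h3] with z hz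
  have hfz := hnn z
  rw [Real.norm_eq_abs, abs_of_nonneg (by positivity)]
  simp only [Pi.add_apply]
  have hpos : 0 ≤ B * 4 ^ (7/4 : ℝ) * ((Metric.ball (0:E3) 1).indicator (fun y => ‖y‖ ^ (-(11/4) : ℝ)) (x - z.1) *
      (1 + ‖z.2‖) ^ (-(7/2) : ℝ)) := by
    have : 0 ≤ (Metric.ball (0:E3) 1).indicator (fun y => ‖y‖ ^ (-(11/4) : ℝ)) (x - z.1) :=
      indicator_apply_nonneg (fun _ => by positivity)
    positivity
  have hkn : 0 ≤ ‖z.2‖ ^ 2 * f z := by positivity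
  set s := ‖x - z.1‖ with hs
  have hs0 : 0 ≤ s := norm_nonneg _
  by_cases hs1 : 1 ≤ s
  · have : f z / s ≤ f z := div_le_self hfz hs1
    linarith
  push Not at hs1
  rcases hs0.eq_or_lt with h0 | h0
  · rw [← h0, div_zero]; positivity
  by_cases hv : 1 ≤ s * ‖z.2‖ ^ 2
  · have : f z / s ≤ ‖z.2‖ ^ 2 * f z := by
      rw [div_le_iff₀ h0]
      nlinarith
    linarith
  push Not at hv
  have hind : (Metric.ball (0:E3) 1).indicator (fun y => ‖y‖ ^ (-(11/4) : ℝ)) (x - z.1)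
      = s ^ (-(11/4) : ℝ) := by
    simp [indicator, ← hs, hs1]
  rw [hind]
  have hkey : f z / s ≤ B * 4 ^ (7/4 : ℝ) * (s ^ (-(11/4) : ℝ) * (1 + ‖z.2‖) ^ (-(7/2) : ℝ)) := by
    set u := 1 + ‖z.2‖ with hu
    have hu0 : 0 < u := by positivity
    have hu2 : s * u ^ 2 ≤ 4 := by
      rw [hu]; nlinarith [norm_nonneg z.2, sq_nonneg (‖z.2‖ - 1)]
    have hq : (s * u ^ 2) ^ (7/4 : ℝ) ≤ 4 ^ (7/4 : ℝ) :=
      Real.rpow_le_rpow (by positivity) hu2 (by norm_num)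
    rw [Real.mul_rpow h0.le (by positivity), ← Real.rpow_natCast u 2, ← Real.rpow_mul hu0.le] at hq
    norm_num at hq
    have e1 : s ^ (-(11/4) : ℝ) = (s * s ^ (7/4:ℝ))⁻¹ := by
      rw [Real.rpow_neg h0.le]
      congr 1
      rw [← Real.rpow_one_add' h0.le (by norm_num)]; norm_num
    rw [e1, Real.rpow_neg hu0.le, ← mul_inv, ← div_eq_mul_inv, div_le_div_iff₀ h0 (by positivity)]
    have hp : 0 ≤ s ^ (7/4:ℝ) * u ^ (7/2:ℝ) := by positivity
    calc f z * (s * s ^ (7/4:ℝ) * u ^ (7/2:ℝ)) = s * (f z * (s ^ (7/4:ℝ) * u ^ (7/2:ℝ))) := by ring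
      _ ≤ s * (B * 4 ^ (7/4:ℝ)) := by gcongr
      _ = _ := by ring
  linarith

lemma int_rho {f : Phase → ℝ} (hf : memE f) (x : E3) :
    Integrable (fun y : E3 => rhoF f y / (4 * π * ‖x - y‖)) := by
  have := ((int_phase hf x).integral_prod_left).div_const (4 * π)
  refine this.congr (Eventually.of_forall fun y => ?_)
  simp only [rhoF]
  rw [integral_div, div_div, mul_comm]

lemma rho_int {f : Phase → ℝ} (hf : memE f) : Integrable (rhoF f) :=
  (memE_parts hf).1.integral_prod_left

lemma rho_mass {f : Phase → ℝ} (hf : memE f) : ∫ y, rhoF f y = mass f :=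
  (integral_prod _ (memE_parts hf).1).symm

lemma rho_nn {f : Phase → ℝ} (hf : memE f) (y : E3) : 0 ≤ rhoF f y :=
  integral_nonneg fun _ => hf.2.1 _

lemma rho_meas {f : Phase → ℝ} (hf : memE f) : Measurable (rhoF f) :=
  (hf.1.stronglyMeasurable.integral_prod_right').measurable

lemma phi_meas {f : Phase → ℝ} (hf : memE f) : Measurable (phiF f) := by
  have hr := rho_meas hf
  have : Measurable (fun p : E3 × E3 => rhoF f p.2 / (4 * π * ‖p.1 - p.2‖)) := by fun_prop
  exact (this.stronglyMeasurable.integral_prod_right').measurable.neg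

lemma rho_rad {f : Phase → ℝ} (hf : memErad f) (y : E3) : rhoF f y = rhoF f (‖y‖ • e0v) := by
  obtain ⟨R, hR, hy⟩ := exists_rot y
  unfold rhoF
  nth_rw 1 [← hy]
  rw [← (R.measurePreserving).integral_comp R.toHomeomorph.measurableEmbedding]
  congr 1
  ext v
  exact hf.2 R hR (‖y‖ • e0v, v)

lemma phi_nonpos {f : Phase → ℝ} (hf : memE f) (x : E3) : phiF f x ≤ 0 := by
  unfold phiF
  rw [neg_nonpos]
  exact integral_nonneg fun y => div_nonneg (rho_nn hf y) (by positivity)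

def Acst (f : Phase → ℝ) : ℝ := 3 * Real.sqrt 2 / π ^ 2 * mass f

lemma mass_nn {f : Phase → ℝ} (hf : memE f) : 0 ≤ mass f := integral_nonneg hf.2.1

lemma phi_lower {f : Phase → ℝ} (hf : memErad f) (r : ℝ) (hr : 0 < r) :
    -phiRad f r ≤ Acst f / r := by
  have hE := hf.1
  have hρm := rho_meas hE
  have hM := mass_nn hE
  have hpol := aux_polar2 (fun t => ENNReal.ofReal (rhoF f (t • e0v)))
    (fun y => ENNReal.ofReal (hw y)) (by fun_prop) (by have := hw_meas; fun_prop)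
    (by intro t ht y; rw [hw_hom t ht])
  simp only [← rho_rad hf] at hpol
  rw [← ofReal_integral_eq_lintegral_ofReal (rho_int hE) (Eventually.of_forall (rho_nn hE)),
    rho_mass hE, EuclideanSpace.volume_ball_fin_three] at hpol
  have hw0 : ∀ y, 0 ≤ hw y := fun y => by unfold hw; positivity
  have hle : ∫⁻ y : E3, ENNReal.ofReal (rhoF f y) * ENNReal.ofReal (hw y)
      ≤ ENNReal.ofReal (mass f * (16 * Real.sqrt 2) / (π * 4 / 3)) := by
    rw [ENNReal.ofReal_div_of_pos (by positivity), ENNReal.le_div_iff_mul_le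
      (Or.inl (by simp; positivity)) (Or.inl (by simp)), ENNReal.ofReal_mul hM]
    calc _ = _ := by
          convert hpol using 2
          simp
      _ ≤ _ := mul_le_mul_right hw_ball _
  have hphi : -phiRad f r = ∫ y : E3, rhoF f y / (4 * π * ‖r • e0v - y‖) := by
    unfold phiRad phiF; simp
  rw [hphi, integral_eq_lintegral_of_nonneg_ae (Eventually.of_forall fun y => div_nonneg (rho_nn hE y) (by positivity))
    (int_rho hE _).aestronglyMeasurable]
  apply ENNReal.toReal_le_of_le_ofReal (by unfold Acst; positivity)
  calc ∫⁻ y : E3, ENNReal.ofReal (rhoF f y / (4 * π * ‖r • e0v - y‖))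
      ≤ ∫⁻ y : E3, ENNReal.ofReal (1 / (4 * π * r)) * (ENNReal.ofReal (rhoF f y) * ENNReal.ofReal (hw y)) := by
        refine lintegral_mono_ae ?_
        filter_upwards [ae_coord 1, ae_coord 2] with y h1 h2
        rw [← ENNReal.ofReal_mul (rho_nn hE y), ← ENNReal.ofReal_mul (by positivity)]
        apply ENNReal.ofReal_le_ofReal
        have := inv_dist_le r hr y h1 h2
        calc rhoF f y / (4 * π * ‖r • e0v - y‖) = (rhoF f y / (4 * π)) * (1 / ‖r • e0v - y‖) := by
              rw [div_mul_div_comm, mul_one]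
          _ ≤ (rhoF f y / (4 * π)) * (hw y / r) :=
              mul_le_mul_of_nonneg_left this (div_nonneg (rho_nn hE y) (by positivity))
          _ = _ := by field_simp
    _ = ENNReal.ofReal (1 / (4 * π * r)) * ∫⁻ y : E3, (ENNReal.ofReal (rhoF f y) * ENNReal.ofReal (hw y)) :=
        lintegral_const_mul' _ _ (by simp)
    _ ≤ ENNReal.ofReal (1 / (4 * π * r)) * ENNReal.ofReal (mass f * (16 * Real.sqrt 2) / (π * 4 / 3)) := by
        gcongr
    _ = ENNReal.ofReal (Acst f / r) := by
        rw [← ENNReal.ofReal_mul (by positivity)]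
        congr 1
        unfold Acst
        field_simp
        ring

lemma mPhi_pos {f : Phase → ℝ} (hf : memE f) (hf0 : ¬ f =ᵐ[volume] (0 : Phase → ℝ)) :
    0 < mPhi f := by
  have hρm := rho_meas hf
  have hi : Integrable (fun y : E3 => rhoF f y / (4 * π * (1 + ‖y‖))) := by
    refine (rho_int hf).mono' (by exact Measurable.aestronglyMeasurable (by fun_prop)) (Eventually.of_forall fun y => ?_)
    rw [Real.norm_eq_abs, abs_of_nonneg (div_nonneg (rho_nn hf y) (by positivity))]
    apply div_le_self (rho_nn hf y)
    nlinarith [Real.pi_gt_three, norm_nonneg y]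
  have hnn : ∀ y : E3, 0 ≤ rhoF f y / (4 * π * (1 + ‖y‖)) :=
    fun y => div_nonneg (rho_nn hf y) (by positivity)
  have hpos : 0 < ∫ y : E3, rhoF f y / (4 * π * (1 + ‖y‖)) := by
    refine lt_of_le_of_ne (integral_nonneg hnn) fun h => hf0 ?_
    have h2 := (integral_eq_zero_iff_of_nonneg hnn hi).1 h.symm
    have h3 : rhoF f =ᵐ[volume] 0 := by
      filter_upwards [h2] with y hy
      have : (4 * π * (1 + ‖y‖)) ≠ 0 := by positivity
      simpa [this, div_eq_zero_iff] using hy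
    have h4 : mass f = 0 := by rw [← rho_mass hf, integral_congr_ae h3]; simp
    exact (integral_eq_zero_iff_of_nonneg hf.2.1 (memE_parts hf).1).1 h4
  refine lt_of_lt_of_le hpos (le_csInf ⟨_, mem_image_of_mem _ (self_mem_Ici : (0:ℝ) ∈ Ici 0)⟩ ?_)
  rintro _ ⟨r, hr, rfl⟩
  have hr : 0 ≤ r := hr
  have hphi : |phiRad f r| = ∫ y : E3, rhoF f y / (4 * π * ‖r • e0v - y‖) := by
    have h0 : phiRad f r ≤ 0 := phi_nonpos hf _
    rw [abs_of_nonpos h0]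
    unfold phiRad phiF; simp
  simp only []
  rw [hphi, ← integral_const_mul]
  refine integral_mono_ae hi ((int_rho hf _).const_mul _) ?_
  have hne : ∀ᵐ y : E3, y ≠ r • e0v := by
    rw [ae_iff]; simp
  filter_upwards [hne] with y hy
  have hd : 0 < ‖r • e0v - y‖ := norm_pos_iff.2 (sub_ne_zero.2 hy.symm)
  have hd2 : ‖r • e0v - y‖ ≤ r + ‖y‖ := by
    refine (norm_sub_le _ _).trans ?_
    simp [norm_smul, abs_of_nonneg hr]
  rw [mul_div_assoc', div_le_div_iff₀ (by positivity) (by positivity)]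
  have h3 : ‖r • e0v - y‖ ≤ (r + 1) * (1 + ‖y‖) := by nlinarith [norm_nonneg y]
  have := mul_le_mul_of_nonneg_left h3 (mul_nonneg (rho_nn hf y) (by positivity : 0 ≤ 4 * π))
  linarith

lemma mPhi_le {f : Phase → ℝ} (hf : memE f) (r : ℝ) (hr : 0 ≤ r) :
    mPhi f / (r + 1) ≤ -phiRad f r := by
  have h0 : phiRad f r ≤ 0 := phi_nonpos hf _
  rw [← abs_of_nonpos h0, div_le_iff₀ (by positivity), mul_comm]
  refine csInf_le ⟨0, ?_⟩ (mem_image_of_mem _ hr)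
  rintro _ ⟨s, hs, rfl⟩
  have hs : 0 ≤ s := hs
  positivity

lemma psi_lower {f : Phase → ℝ} (hf : memErad f) (ℓ : ℝ) (r : ℝ) (hr : 0 < r) :
    ℓ / (2 * r ^ 2) - Acst f / r ≤ psiPot (phiRad f) ℓ r := by
  unfold psiPot
  linarith [phi_lower hf r hr]

lemma Acst_nn {f : Phase → ℝ} (hf : memE f) : 0 ≤ Acst f := by
  have := mass_nn hf
  unfold Acst; positivity

lemma psi_bdd {f : Phase → ℝ} (hf : memErad f) (ℓ : ℝ) (hl : 0 < ℓ) :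
    BddBelow (psiPot (phiRad f) ℓ '' Ioi 0) := by
  refine ⟨-(Acst f) ^ 2 / (2 * ℓ), ?_⟩
  rintro _ ⟨r, hr, rfl⟩
  have hr : 0 < r := hr
  refine le_trans ?_ (psi_lower hf ℓ r hr)
  have : ℓ / (2 * r ^ 2) - Acst f / r - (-(Acst f) ^ 2 / (2 * ℓ))
      = (ℓ / r - Acst f) ^ 2 / (2 * ℓ) := by field_simp; ring
  have h2 : 0 ≤ (ℓ / r - Acst f) ^ 2 / (2 * ℓ) := by positivity
  linarith

lemma psi_meas {f : Phase → ℝ} (hf : memE f) (ℓ : ℝ) : Measurable (psiPot (phiRad f) ℓ) := by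
  have h := phi_meas hf
  have h2 : Measurable (phiRad f) := by
    unfold phiRad; fun_prop
  unfold psiPot
  fun_prop

lemma a_dom {f : Phase → ℝ} (hf : memErad f) (ℓ : ℝ) (hl : 0 < ℓ) (e : ℝ) (he : e < 0)
    (r : ℝ) (hr : 0 < r) :
    Real.sqrt (max (e - psiPot (phiRad f) ℓ r) 0) ≤
      (Iic (Acst f / |e|)).indicator (fun r => Real.sqrt (Acst f) * r ^ (-(1/2) : ℝ)) r := by
  have hA := Acst_nn hf.1
  have hp := psi_lower hf ℓ r hr
  have hq : 0 < ℓ / (2 * r ^ 2) := by positivity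
  have he' : |e| = -e := abs_of_neg he
  by_cases h : r ≤ Acst f / |e|
  · rw [indicator_of_mem (mem_Iic.2 h), Real.rpow_neg hr.le, ← Real.sqrt_eq_rpow, ← div_eq_mul_inv,
      ← Real.sqrt_div hA]
    apply Real.sqrt_le_sqrt
    apply max_le
    · linarith
    · positivity
  · rw [indicator_of_notMem (by simpa using h)]
    push Not at h
    rw [he', div_lt_iff₀ (by linarith)] at h
    have : Acst f / r < -e := by rw [div_lt_iff₀ hr]; linarith
    rw [max_eq_right (by linarith)]; simp

lemma dom_int (A c : ℝ) (hc : 0 ≤ c) :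
    IntegrableOn ((Iic c).indicator (fun r => Real.sqrt A * r ^ (-(1/2) : ℝ))) (Ioi 0) ∧
    ∫ r in Ioi (0:ℝ), (Iic c).indicator (fun r => Real.sqrt A * r ^ (-(1/2) : ℝ)) r
      = Real.sqrt A * (2 * Real.sqrt c) := by
  constructor
  · rw [IntegrableOn, integrable_indicator_iff measurableSet_Iic, IntegrableOn,
      Measure.restrict_restrict measurableSet_Iic, inter_comm, Ioi_inter_Iic, ← IntegrableOn,
      ← intervalIntegrable_iff_integrableOn_Ioc_of_le hc]
    exact (intervalIntegral.intervalIntegrable_rpow' (by norm_num)).const_mul _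
  · rw [setIntegral_indicator measurableSet_Iic, Ioi_inter_Iic, ← intervalIntegral.integral_of_le hc,
      intervalIntegral.integral_const_mul, integral_rpow (by norm_num), Real.sqrt_eq_rpow c]
    norm_num
    ring_nf
    simp

lemma a_int {f : Phase → ℝ} (hf : memErad f) (ℓ : ℝ) (hl : 0 < ℓ) (e : ℝ) (he : e < 0) :
    IntegrableOn (fun r => Real.sqrt (max (e - psiPot (phiRad f) ℓ r) 0)) (Ioi 0) := by
  have hA := Acst_nn hf.1
  have hm := psi_meas hf.1 ℓ
  refine Integrable.mono' (dom_int (Acst f) (Acst f / |e|) (by positivity)).1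
    (by exact Measurable.aestronglyMeasurable (by fun_prop)) ?_
  filter_upwards [ae_restrict_mem measurableSet_Ioi] with r hr
  rw [Real.norm_eq_abs, abs_of_nonneg (Real.sqrt_nonneg _)]
  exact a_dom hf ℓ hl e he r hr

lemma a_upper {f : Phase → ℝ} (hf : memErad f) (ℓ : ℝ) (hl : 0 < ℓ) (e : ℝ) (he : e < 0) :
    aPot (phiRad f) e ℓ ≤ 16 * π ^ 2 * mass f / Real.sqrt |e| := by
  have hA := Acst_nn hf.1
  have hM := mass_nn hf.1
  have he' : 0 < |e| := abs_pos.2 he.ne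
  have hd := dom_int (Acst f) (Acst f / |e|) (by positivity)
  have h1 : ∫ r in Ioi (0:ℝ), Real.sqrt (max (e - psiPot (phiRad f) ℓ r) 0)
      ≤ Real.sqrt (Acst f) * (2 * Real.sqrt (Acst f / |e|)) := by
    rw [← hd.2]
    exact setIntegral_mono_on (a_int hf ℓ hl e he) hd.1 measurableSet_Ioi
      (fun r hr => a_dom hf ℓ hl e he r hr)
  have h2 : Real.sqrt (Acst f) * (2 * Real.sqrt (Acst f / |e|)) = 2 * Acst f / Real.sqrt |e| := by
    rw [Real.sqrt_div hA]
    have := Real.mul_self_sqrt hA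
    field_simp
    rw [sq]; exact this
  rw [h2] at h1
  have hs : 0 < Real.sqrt |e| := Real.sqrt_pos.2 he'
  unfold aPot
  calc _ ≤ 8 * π ^ 2 * Real.sqrt 2 * (2 * Acst f / Real.sqrt |e|) := by gcongr
    _ = 96 * mass f / Real.sqrt |e| := by
      unfold Acst
      have : Real.sqrt 2 * Real.sqrt 2 = 2 := Real.mul_self_sqrt (by norm_num)
      field_simp
      linear_combination 48 * mass f * this
    _ ≤ _ := by
      gcongr
      nlinarith [Real.pi_gt_three]

lemma a_lower {f : Phase → ℝ} (hf : memErad f) (hm : 0 < mPhi f) (ℓ : ℝ) (hl : 0 < ℓ) (e : ℝ)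
    (hle : -(mPhi f) ^ 2 / (4 * (2 * mPhi f + ℓ)) ≤ e) (he : e < 0) :
    4 * π ^ 2 / 3 * mPhi f / Real.sqrt |e| ≤ aPot (phiRad f) e ℓ := by
  set m := mPhi f with hmdef
  obtain ⟨ε, rfl⟩ : ∃ ε, e = -ε := ⟨-e, by ring⟩
  have hε : 0 < ε := by linarith
  rw [abs_neg, abs_of_pos hε]
  have h1 : ε * (4 * (2 * m + ℓ)) ≤ m ^ 2 := by
    rw [neg_div, neg_le_neg_iff, le_div_iff₀ (by positivity)] at hle
    exact hle
  have hab : m / (4 * ε) ≤ m / (2 * ε) := by gcongr; norm_num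
  have hpt : ∀ r ∈ Ioc (m / (4 * ε)) (m / (2 * ε)),
      Real.sqrt (ε / 2) ≤ Real.sqrt (max (-ε - psiPot (phiRad f) ℓ r) 0) := by
    rintro r ⟨ha, hb⟩
    have hr : 0 < r := lt_trans (by positivity) ha
    apply Real.sqrt_le_sqrt
    refine le_trans ?_ (le_max_left _ _)
    have hp := mPhi_le hf.1 r hr.le
    rw [← hmdef] at hp
    unfold psiPot
    rw [div_lt_iff₀ (by positivity)] at ha
    rw [le_div_iff₀ (by positivity)] at hb
    have h2 : m / r - m / r ^ 2 ≤ m / (r + 1) := by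
      have : m / (r + 1) - (m / r - m / r ^ 2) = m / (r ^ 2 * (r + 1)) := by field_simp; ring
      have h0 : 0 ≤ m / (r ^ 2 * (r + 1)) := by positivity
      linarith
    have h3 : ε / 2 + ε ≤ m / r - m / r ^ 2 - ℓ / (2 * r ^ 2) := by
      have : m / r - m / r ^ 2 - ℓ / (2 * r ^ 2) = (2 * m * r - 2 * m - ℓ) / (2 * r ^ 2) := by
        field_simp
      rw [this, le_div_iff₀ (by positivity)]
      have key : ε * ((ε / 2 + ε) * (2 * r ^ 2)) ≤ ε * (2 * m * r - 2 * m - ℓ) := by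
        nlinarith [mul_nonneg (sub_nonneg.2 hb) (sub_nonneg.2 ha.le), mul_pos hε hr]
      exact le_of_mul_le_mul_left key hε
    linarith
  have hI := a_int hf ℓ hl (-ε) (by linarith)
  have hsub : Ioc (m / (4 * ε)) (m / (2 * ε)) ⊆ Ioi 0 := fun r hr =>
    lt_trans (by positivity : 0 < m / (4 * ε)) hr.1
  have h4 : ∫ r in Ioc (m / (4 * ε)) (m / (2 * ε)), Real.sqrt (ε / 2)
      ≤ ∫ r in Ioi (0:ℝ), Real.sqrt (max (-ε - psiPot (phiRad f) ℓ r) 0) := by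
    refine le_trans (setIntegral_mono_on (by simp) (hI.mono_set hsub) measurableSet_Ioc hpt) ?_
    exact setIntegral_mono_set hI (Eventually.of_forall fun r => Real.sqrt_nonneg _)
      hsub.eventuallyLE
  rw [setIntegral_const] at h4
  simp only [smul_eq_mul, measureReal_def, Real.volume_Ioc] at h4
  rw [ENNReal.toReal_ofReal (by linarith)] at h4
  unfold aPot
  refine le_trans ?_ (mul_le_mul_of_nonneg_left h4 (by positivity))
  rw [Real.sqrt_div hε.le]
  have hs : 0 < Real.sqrt ε := Real.sqrt_pos.2 hε
  have hss : Real.sqrt ε * Real.sqrt ε = ε := Real.mul_self_sqrt hε.le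
  have : 8 * π ^ 2 * Real.sqrt 2 * ((m / (2 * ε) - m / (4 * ε)) * (Real.sqrt ε / Real.sqrt 2))
      = 2 * π ^ 2 * m / Real.sqrt ε := by
    field_simp
    linear_combination (16:ℝ) * hss
  rw [this]
  gcongr
  nlinarith [Real.pi_pos, sq_nonneg π]

/-- Behavior and uniform bounds for the Jacobian `a_φ`. -/
theorem stmt7 (f : Phase → ℝ) (hf : memErad f)
    (hf0 : ¬ f =ᵐ[volume] (0 : Phase → ℝ)) :
    (∀ ℓ : ℝ, 0 < ℓ →
      (∀ e : ℝ, e ≤ eMinPot (phiRad f) ℓ → aPot (phiRad f) e ℓ = 0) ∧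
      Tendsto (fun e => aPot (phiRad f) e ℓ) (nhdsWithin 0 (Iio 0)) atTop) ∧
    (0 < mPhi f) ∧
    (∀ ℓ : ℝ, 0 < ℓ → ∀ e : ℝ, e < 0 →
      aPot (phiRad f) e ℓ ≤ 16 * π ^ 2 * mass f / Real.sqrt |e|) ∧
    (∀ ℓ : ℝ, 0 < ℓ → ∀ e : ℝ,
      -(mPhi f) ^ 2 / (4 * (2 * mPhi f + ℓ)) ≤ e → e < 0 →
      4 * π ^ 2 / 3 * mPhi f / Real.sqrt |e| ≤ aPot (phiRad f) e ℓ) := by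
  have hm := mPhi_pos hf.1 hf0
  refine ⟨fun ℓ hl => ⟨fun e he => ?_, ?_⟩, hm, fun ℓ hl e he => a_upper hf ℓ hl e he,
    fun ℓ hl e h1 h2 => a_lower hf hm ℓ hl e h1 h2⟩
  · unfold aPot
    rw [setIntegral_eq_zero_of_forall_eq_zero, mul_zero]
    intro r hr
    have : eMinPot (phiRad f) ℓ ≤ psiPot (phiRad f) ℓ r :=
      csInf_le (psi_bdd hf ℓ hl) (mem_image_of_mem _ hr)
    rw [max_eq_right (by linarith), Real.sqrt_zero]
  · have hc : 0 < 4 * π ^ 2 / 3 * mPhi f := by positivity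
    have ht : Tendsto (fun e : ℝ => 4 * π ^ 2 / 3 * mPhi f / Real.sqrt |e|)
        (nhdsWithin 0 (Iio 0)) atTop := by
      have h0 : Tendsto (fun e : ℝ => Real.sqrt |e|) (nhdsWithin 0 (Iio 0)) (nhdsWithin 0 (Ioi 0)) := by
        refine tendsto_nhdsWithin_iff.2 ⟨?_, ?_⟩
        · have : Continuous (fun e : ℝ => Real.sqrt |e|) := by fun_prop
          have h := this.tendsto 0
          simp only [abs_zero, Real.sqrt_zero] at h
          exact h.mono_left nhdsWithin_le_nhds
        · filter_upwards [self_mem_nhdsWithin] with e he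
          exact Real.sqrt_pos.2 (abs_pos.2 (ne_of_lt he))
      simp only [div_eq_mul_inv _ (Real.sqrt _)]
      exact (tendsto_inv_nhdsGT_zero.comp h0).const_mul_atTop hc
    refine tendsto_atTop_mono' _ ?_ ht
    have hneg : -(mPhi f) ^ 2 / (4 * (2 * mPhi f + ℓ)) < 0 :=
      div_neg_of_neg_of_pos (by nlinarith) (by positivity)
    filter_upwards [Ioo_mem_nhdsLT hneg] with e he
    exact a_lower hf hm ℓ hl e he.1.le he.2
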